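/- Let T be a triangulated category. Suppose given commutative squares: u₁ : X₁ → X₂, f₁ : X₁ → Y₁, f₂ : X₂ → Y₂, u₂ : Y₁ → Y₂ with f₂ ∘ u₁ = u₂ ∘ f₁, and ν₁ : X₂ → X₃, f₃ : X₃ → Y₃, ν₂ : Y₂ → Y₃ with f₃ ∘ ν₁ = ν₂ ∘ f₂. If the square (u₁, f₁, f₂, u₂) is homotopy cartesian and the composed square (ν₁ ∘ u₁, f₁, f₃, ν₂ ∘ u₂) is homotopy cartesian, then there exists a morphism ν̂₂ : Y₂ → Y₃ with ν̂₂ ∘ u₂ = ν₂ ∘ u₂ such that the square (ν₁, f₂, f₃, ν̂₂) is commutative and homotopy cartesian. -/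

import Mathlib

open CategoryTheory CategoryTheory.Limits CategoryTheory.Pretriangulated

variable {T : Type*} [Category T] [Preadditive T] [HasZeroObject T]
  [HasShift T ℤ] [∀ n : ℤ, (CategoryTheory.shiftFunctor T n).Additive]
  [Pretriangulated T]

/-- A commutative square `c ∘ a = d ∘ b` (with `a : A ⟶ C`, `b : A ⟶ B`, `c : C ⟶ D`,
`d : B ⟶ D`) is *homotopy cartesian* if there is `e : D ⟶ A⟦1⟧` such that
`A ⟶ B ⊞ C ⟶ D ⟶ A⟦1⟧` is a distinguished triangle, where the first map has components
`b` and `a` and the second map has components `d` and `-c`. -/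
def HomotopyCartesian {A B C D : T} (a : A ⟶ C) (b : A ⟶ B) (c : C ⟶ D) (d : B ⟶ D) : Prop :=
  ∃ e : D ⟶ A⟦(1 : ℤ)⟧,
    Triangle.mk (biprod.lift b a) (biprod.desc d (-c)) e ∈ distTriang T

/-- A triangle is distinguished if it is isomorphic to a distinguished one, in unbundled form. -/
lemma distinguished_of_iso {X Y Z X' Y' Z' : T} {f : X ⟶ Y} {g : Y ⟶ Z} {h : Z ⟶ X⟦(1 : ℤ)⟧}
    {f' : X' ⟶ Y'} {g' : Y' ⟶ Z'} {h' : Z' ⟶ X'⟦(1 : ℤ)⟧}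
    (hT : Triangle.mk f' g' h' ∈ distTriang T) (e₁ : X ≅ X') (e₂ : Y ≅ Y') (e₃ : Z ≅ Z')
    (comm₁ : f ≫ e₂.hom = e₁.hom ≫ f') (comm₂ : g ≫ e₃.hom = e₂.hom ≫ g')
    (comm₃ : h ≫ e₁.hom⟦(1 : ℤ)⟧' = e₃.hom ≫ h') :
    Triangle.mk f g h ∈ distTriang T :=
  isomorphic_distinguished _ hT _ (Triangle.isoMk _ _ e₁ e₂ e₃ comm₁ comm₂ comm₃)

/-- A split triangle `X ⟶ Y ⟶ Z` with a section `s` of its second morphism identifies `Y`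
with `X ⊞ Z`. -/
lemma isIso_biprod_desc_of_distinguished {X Y Z : T} {f : X ⟶ Y} {g : Y ⟶ Z}
    (hT : Triangle.mk f g (0 : Z ⟶ X⟦(1 : ℤ)⟧) ∈ distTriang T) (s : Z ⟶ Y) (hs : s ≫ g = 𝟙 Z) :
    IsIso (biprod.desc f s) := by
  have hfg : f ≫ g = 0 := comp_distTriang_mor_zero₁₂ _ hT
  have comm₁ : biprod.inl ≫ biprod.desc f s = 𝟙 X ≫ f := by simp
  have comm₂ : biprod.snd ≫ 𝟙 Z = biprod.desc f s ≫ g := by ext <;> simp [hfg, hs]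
  have comm₃ : (0 : Z ⟶ X⟦(1 : ℤ)⟧) ≫ (𝟙 X)⟦(1 : ℤ)⟧' = 𝟙 Z ≫ 0 := by simp
  exact isIso₂_of_isIso₁₃ (Triangle.homMk (binaryBiproductTriangle X Z)
    (Triangle.mk f g 0) (𝟙 X) (biprod.desc f s) (𝟙 Z) comm₁ comm₂ comm₃) (binaryBiproductTriangle_distinguished X Z) hT
    (inferInstanceAs (IsIso (𝟙 X))) (inferInstanceAs (IsIso (𝟙 Z)))

/-- The direct sum of a distinguished triangle `X ⟶ Y ⟶ Z ⟶ X⟦1⟧` and the triangle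
`0 ⟶ W ⟶ W ⟶ 0` is distinguished. -/
lemma distinguished_lift_zero [IsTriangulated T] {X Y Z : T} {f : X ⟶ Y} {g : Y ⟶ Z}
    {h : Z ⟶ X⟦(1 : ℤ)⟧} (hT : Triangle.mk f g h ∈ distTriang T) (W : T) :
    Triangle.mk (biprod.lift f (0 : X ⟶ W)) (biprod.map g (𝟙 W)) (biprod.desc h 0) ∈
      distTriang T := by
  obtain ⟨C, v, w, hC⟩ := distinguished_cocone_triangle (biprod.lift f (0 : X ⟶ W))
  have hYW : Triangle.mk (biprod.inl : Y ⟶ Y ⊞ W) biprod.snd 0 ∈ distTriang T :=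
    binaryBiproductTriangle_distinguished Y W
  have o := Triangulated.someOctahedron (u₁₃ := biprod.lift f (0 : X ⟶ W))
    (by ext <;> simp) hT hYW hC
  have hvw : v ≫ w = 0 := comp_distTriang_mor_zero₂₃ _ hC
  have hm : Triangle.mk o.m₁ o.m₃ (0 : W ⟶ Z⟦(1 : ℤ)⟧) ∈ distTriang T := by
    simpa using o.mem
  have := isIso_biprod_desc_of_distinguished hm (biprod.inr ≫ v) (by simp [o.comm₃])
  refine distinguished_of_iso hC (Iso.refl _) (Iso.refl _)
    (asIso (biprod.desc o.m₁ (biprod.inr ≫ v))) ?_ ?_ ?_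
  · simp
  · ext <;> simp [o.comm₁]
  · ext <;> simp [o.comm₂, hvw]

/-- The split distinguished triangle whose second morphism is
`(y, x, z) ↦ (y, ν x + z)`. -/
lemma distinguished_shear (Y : T) {X Z : T} (ν : X ⟶ Z) :
    Triangle.mk (biprod.lift (biprod.lift (0 : X ⟶ Y) (-𝟙 X)) ν)
      (biprod.lift (biprod.fst ≫ biprod.fst) (biprod.desc (biprod.snd ≫ ν) (𝟙 Z)))
      (0 : Y ⊞ Z ⟶ X⟦(1 : ℤ)⟧) ∈ distTriang T := by
  refine distinguished_of_iso (binaryBiproductTriangle_distinguished X (Y ⊞ Z)) (Iso.refl _)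
    { hom := biprod.lift (-(biprod.fst ≫ biprod.snd))
        (biprod.lift (biprod.fst ≫ biprod.fst) (biprod.desc (biprod.snd ≫ ν) (𝟙 Z)))
      inv := biprod.lift (biprod.lift (biprod.snd ≫ biprod.fst) (-biprod.fst))
        (biprod.desc ν biprod.snd)
      hom_inv_id := ?_
      inv_hom_id := ?_ } (Iso.refl _) ?_ ?_ ?_
  · ext <;> simp [biprod.lift_desc]
  · ext <;> simp [biprod.lift_desc]
  · ext <;> simp [biprod.lift_desc]
  · ext <;> simp
  · simp

/-- **Lemma (partial converse to composition of homotopy cartesian squares).**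
Given commutative squares `(u₁, f₁, f₂, u₂)` and `(ν₁, f₂, f₃, ν₂)`, if the first square
and the composed square `(ν₁ ∘ u₁, f₁, f₃, ν₂ ∘ u₂)` are homotopy cartesian, then there is
`ν̂₂ : Y₂ ⟶ Y₃` with `ν̂₂ ∘ u₂ = ν₂ ∘ u₂` such that the square `(ν₁, f₂, f₃, ν̂₂)` is
commutative and homotopy cartesian. -/
theorem homotopyCartesian_cancel [IsTriangulated T]
    {X₁ X₂ X₃ Y₁ Y₂ Y₃ : T}
    (u₁ : X₁ ⟶ X₂) (f₁ : X₁ ⟶ Y₁) (f₂ : X₂ ⟶ Y₂) (u₂ : Y₁ ⟶ Y₂)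
    (ν₁ : X₂ ⟶ X₃) (f₃ : X₃ ⟶ Y₃) (ν₂ : Y₂ ⟶ Y₃)
    (hcomm₁ : u₁ ≫ f₂ = f₁ ≫ u₂)
    (hcomm₂ : ν₁ ≫ f₃ = f₂ ≫ ν₂)
    (h1 : HomotopyCartesian u₁ f₁ f₂ u₂)
    (h2 : HomotopyCartesian (u₁ ≫ ν₁) f₁ f₃ (u₂ ≫ ν₂)) :
    ∃ ν₂' : Y₂ ⟶ Y₃, u₂ ≫ ν₂' = u₂ ≫ ν₂ ∧ ν₁ ≫ f₃ = f₂ ≫ ν₂' ∧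
      HomotopyCartesian ν₁ f₂ f₃ ν₂' := by
  obtain ⟨e₁, h₁⟩ := h1
  obtain ⟨e₂, h₂⟩ := h2
  have o := Triangulated.someOctahedron
    (u₁₃ := biprod.lift f₁ (u₁ ≫ ν₁)) (by ext <;> simp [biprod.lift_desc])
    (distinguished_lift_zero h₁ X₃) (rot_of_distTriang _ (distinguished_shear Y₁ ν₁)) h₂
  have hm := o.comm₁
  have hY₁ : u₂ ≫ biprod.inl ≫ o.m₁ = u₂ ≫ ν₂ := by
    simpa using (biprod.inl ≫ biprod.inl) ≫= hm
  have hX₂ : f₂ ≫ biprod.inl ≫ o.m₁ = ν₁ ≫ f₃ := by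
    simpa using (biprod.inr ≫ biprod.inl) ≫= hm
  have hX₃ : biprod.inr ≫ o.m₁ = -f₃ := by
    simpa using biprod.inr ≫= hm
  refine ⟨biprod.inl ≫ o.m₁, hY₁, hX₂.symm, o.m₃, ?_⟩
  have hdesc : biprod.desc (biprod.inl ≫ o.m₁) (-f₃) = o.m₁ := by
    ext <;> simp [hX₃]
  have hlift : biprod.lift (biprod.lift (0 : X₂ ⟶ Y₁) (-𝟙 X₂)) ν₁ ≫
      biprod.map (biprod.desc u₂ (-f₂)) (𝟙 X₃) = biprod.lift f₂ ν₁ := by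
    ext <;> simp [biprod.lift_desc]
  rw [rotate_distinguished_triangle, hdesc, ← hlift]
  change Triangle.mk o.m₁ o.m₃ (-(biprod.lift (biprod.lift (0 : X₂ ⟶ Y₁) (-𝟙 X₂)) ν₁ ≫
    biprod.map (biprod.desc u₂ (-f₂)) (𝟙 X₃))⟦(1 : ℤ)⟧') ∈ distTriang T
  rw [Functor.map_comp, ← Preadditive.neg_comp]
  exact o.mem
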